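/- For the optimal parameter c = −4/13 and any fixed ω ∈ ℝ, the h⁴ error term of the principal symbol vanishes and the approximation gains an order: (Q̂₁(hω; h) + ω²)/h⁵ → 0 as h → 0⁺. -/

import Mathlib

open Filter Topology

/-- `Ω(θ) = −cos(θ/2)(16 − (7 + cos θ)c)`. -/
noncomputable def Om (c θ : ℝ) : ℝ :=
  -Real.cos (θ/2) * (16 - (7 + Real.cos θ)*c)

/-- `Δ(θ) = √(Ω(θ)² + 4c² sin⁶(θ/2))`. -/
noncomputable def Del (c θ : ℝ) : ℝ :=
  Real.sqrt ((Om c θ)^2 + 4*c^2*(Real.sin (θ/2))^6)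

/-- The principal symbol `Q̂₁(θ; h)`. -/
noncomputable def Qhat1 (c h θ : ℝ) : ℝ :=
  (2/(3*h^2)) * (-(15 + Real.cos θ) + (5 + 3*Real.cos θ)*c + Del c θ)

/-- The spurious symbol `Q̂₂(θ; h)`. -/
noncomputable def Qhat2 (c h θ : ℝ) : ℝ :=
  (2/(3*h^2)) * (-(15 + Real.cos θ) + (5 + 3*Real.cos θ)*c - Del c θ)

theorem cos_bound_eight (x : ℝ) (hx : |x| ≤ 1) :
    |Real.cos x - (1 - x^2/2 + x^4/24 - x^6/720)| ≤ x^8/1000 := by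
  have hn : ‖(x : ℂ) * Complex.I‖ = |x| := by simp
  have h := Complex.exp_bound (x := (x : ℂ) * Complex.I) (by rw [hn]; exact hx)
    (n := 8) (by norm_num)
  have h2 := (Complex.abs_re_le_norm _).trans h
  rw [hn, (by decide : Even 8).pow_abs] at h2
  have hs : (∑ m ∈ Finset.range 8, ((x : ℂ) * Complex.I) ^ m / (m.factorial : ℂ)) =
      ((1 - x^2/2 + x^4/24 - x^6/720 : ℝ) : ℂ) +
      ((x - x^3/6 + x^5/120 - x^7/5040 : ℝ) : ℂ) * Complex.I := by
    simp only [Finset.sum_range_succ, Finset.sum_range_zero, Nat.factorial, mul_pow]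
    have e2 := Complex.I_sq
    have e3 : Complex.I ^ 3 = - Complex.I := by rw [pow_succ, e2]; ring
    have e4 : Complex.I ^ 4 = 1 := Complex.I_pow_four
    have e5 : Complex.I ^ 5 = Complex.I := by rw [pow_succ, e4]; ring
    have e6 : Complex.I ^ 6 = -1 := by rw [pow_succ, e5, ← e2]; ring
    have e7 : Complex.I ^ 7 = -Complex.I := by rw [pow_succ, e6]; ring
    rw [e2, e3, e4, e5, e6, e7]
    push_cast
    ring
  rw [hs, Complex.sub_re, Complex.exp_ofReal_mul_I_re, Complex.add_re, Complex.re_ofReal_mul,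
    Complex.ofReal_re, Complex.I_re, mul_zero, add_zero] at h2
  refine h2.trans ?_
  have h8 : 0 ≤ x^8 := by positivity
  norm_num [Nat.factorial]
  linarith

theorem Del_bound (x : ℝ) (hx : |x| ≤ 1) :
    |13 * Del (-4/13) x - (215 + 25 * Real.cos x - 39/2 * x^2)| ≤ x^8 := by
  have hr := cos_bound_eight x hx
  have hC1 := Real.neg_one_le_cos x
  have hD0 : 0 ≤ Del (-4/13) x := Real.sqrt_nonneg _
  have hDsq : (13 * Del (-4/13) x)^2 =
      57600 - 30720 * (1 - Real.cos x) + 976 * (1 - Real.cos x)^2 := by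
    have hc : Real.cos (x/2)^2 = (1 + Real.cos x)/2 := by
      rw [Real.cos_sq, show 2 * (x/2) = x by ring]; ring
    have hs : Real.sin (x/2)^2 = (1 - Real.cos x)/2 := by
      rw [Real.sin_sq, hc]; ring
    rw [mul_pow, Del, Real.sq_sqrt (by positivity), Om,
      show Real.sin (x/2)^6 = (Real.sin (x/2)^2)^3 by ring, hs, mul_pow, neg_sq, hc]
    ring
  set D := 13 * Del (-4/13) x with hD
  have hD0' : 0 ≤ D := by positivity
  set C := Real.cos x
  obtain ⟨t, ht⟩ : ∃ t, t = x^2 := ⟨_, rfl⟩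
  have ht0 : 0 ≤ t := by rw [ht]; positivity
  have ht1 : t ≤ 1 := by rw [ht]; exact (sq_le_one_iff_abs_le_one x).2 hx
  obtain ⟨r, hrr⟩ : ∃ r, r = C - (1 - x^2/2 + x^4/24 - x^6/720) := ⟨_, rfl⟩
  rw [← hrr, show x^8 = t^4 by rw [ht]; ring] at hr
  have hCe : C = 1 - t/2 + t^2/24 - t^3/720 + r := by rw [hrr, ht]; ring
  rw [show x^8 = t^4 by rw [ht]; ring, ← ht]
  set P := 215 + 25 * C - 39/2 * t with hP
  have hP0 : 170 ≤ P := by rw [hP]; linarith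
  have ht4 : t^4 ≤ 1 := pow_le_one₀ ht0 ht1
  have ht2 : t^2 ≤ 1 := pow_le_one₀ ht0 ht1
  have ht3 : t^3 ≤ 1 := pow_le_one₀ ht0 ht1
  have p2 : 0 ≤ t^2 := by positivity
  have p3 : 0 ≤ t^3 := by positivity
  have p4 : 0 ≤ t^4 := by positivity
  have hF : D^2 - P^2 = t^4 * ((351*(1/576+1/720) - 975/720) - 351*2/17280*t + 351/518400*t^2)
      + r * (18720 + 351 * (-2*(t/2 - t^2/24 + t^3/720) + r) + 975 * t) := by
    rw [hDsq, hP, hCe]; ring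
  have hr1 := abs_le.1 hr
  have b1 : |(351*(1/576+1/720) - 975/720) - 351*2/17280*t + 351/518400*t^2| ≤ 1 := by
    rw [abs_le]; constructor <;> linarith
  have b2 : |18720 + 351 * (-2*(t/2 - t^2/24 + t^3/720) + r) + 975 * t| ≤ 30000 := by
    rw [abs_le]; constructor <;> linarith
  have hFb : |D^2 - P^2| ≤ 170 * t^4 := by
    rw [hF]
    refine (abs_add_le _ _).trans ?_
    rw [abs_mul, abs_mul, abs_of_nonneg p4]
    have := mul_le_mul_of_nonneg_left b1 p4
    have := mul_le_mul hr b2 (abs_nonneg _) (by positivity)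
    linarith
  have hm : |D^2 - P^2| = (D + P) * |D - P| := by
    rw [sq_sub_sq, abs_mul, abs_of_nonneg (by linarith : 0 ≤ D + P)]
  have := mul_le_mul_of_nonneg_right (by linarith : 170 ≤ D + P) (abs_nonneg (D - P))
  linarith

/-- For the optimal parameter `c = −4/13`, the `h⁴` error term of the principal
symbol vanishes and the approximation gains an order:
`(Q̂₁(hω; h) + ω²)/h⁵ → 0` as `h → 0⁺`. -/
theorem Qhat1_fifth_order_optimal (ω : ℝ) :
    Tendsto (fun h : ℝ => (Qhat1 (-4/13) h (h*ω) + ω^2)/h^5) (𝓝[>] 0)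
      (𝓝 0) := by
  have hlim : Tendsto (fun h : ℝ => ω^8 * h) (𝓝[>] 0) (𝓝 0) := by
    have : Tendsto (fun h : ℝ => ω^8 * h) (𝓝 0) (𝓝 (ω^8 * 0)) :=
      (continuous_const.mul continuous_id).tendsto 0
    rw [mul_zero] at this
    exact this.mono_left nhdsWithin_le_nhds
  have hsm : ∀ᶠ h : ℝ in 𝓝[>] 0, |h*ω| < 1 := by
    have : Tendsto (fun h : ℝ => |h*ω|) (𝓝 0) (𝓝 |0*ω|) :=
      (continuous_id.mul continuous_const).abs.tendsto 0
    rw [zero_mul, abs_zero] at this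
    exact (this.mono_left nhdsWithin_le_nhds).eventually (gt_mem_nhds one_pos)
  refine squeeze_zero_norm' ?_ hlim
  filter_upwards [hsm, self_mem_nhdsWithin] with h h1 hpos
  have hh : (0:ℝ) < h := hpos
  have hb := Del_bound (h*ω) h1.le
  have e : (Qhat1 (-4/13) h (h*ω) + ω^2)/h^5 = 2/39 *
      (13 * Del (-4/13) (h*ω) - (215 + 25 * Real.cos (h*ω) - 39/2 * (h*ω)^2)) / h^7 := by
    rw [Qhat1]
    field_simp
    ring
  rw [e, Real.norm_eq_abs, abs_div, abs_mul, abs_of_pos (by positivity : (0:ℝ) < h^7),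
    abs_of_pos (by norm_num : (0:ℝ) < 2/39), div_le_iff₀ (by positivity)]
  have e2 : ω^8 * h * h^7 = (h*ω)^8 := by ring
  rw [e2]
  have : 0 ≤ (h*ω)^8 := by positivity
  linarith
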